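/- arXiv:2101.04052 — 2 statements merged into one kernel-verified Lean document; each statement's English description precedes it below -/
import Mathlib

section
/- For every integer q ≥ 1 and integer k ≥ 0: d'_q(k) = 0 for every k ≥ 2; d'_q(1) = −(2q−1)(2q−2)·c_q; and d'_q(0) = −(2q−1)·c_q. -/
open Finset

/-- `a_q(l) = 1/(l!(q-l)!) · 1/(2l-1)`. -/
noncomputable def aCoeff (q l : ℕ) : ℝ :=
  (1 / ((l.factorial : ℝ) * ((q - l).factorial : ℝ))) * (1 / (2 * (l : ℝ) - 1))

/-- `b_q(l₁,l₂,n)`; all factorial arguments are non-negative in the admissible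
range (we use truncated subtraction on `ℕ`). -/
noncomputable def bCoeff (q l₁ l₂ n : ℕ) : ℝ :=
  ((2 * q - 2 * l₁).factorial * (2 * l₁).factorial *
      (2 * q - 2 * l₂).factorial * (2 * l₂).factorial : ℝ) /
    ((2 * q + n - 2 * l₁ - 2 * l₂).factorial * (2 * l₁ - n).factorial *
      (2 * l₂ - n).factorial * n.factorial : ℝ)

/-- `c_q = 2^{4q} (q!)² / (2q · (2q)!)`. -/
noncomputable def cCoeff (q : ℕ) : ℝ :=
  2 ^ (4 * q) * (q.factorial : ℝ) ^ 2 / (2 * (q : ℝ) * ((2 * q).factorial : ℝ))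

/-- `d'_q(k) = Σ (2q−l₁−l₂−k)(−1)^{l₁+l₂−1} a_q(l₁) a_q(l₂) b_q(l₁,l₂,l₁+l₂−k)`,
summed over pairs `0 ≤ l₁,l₂ ≤ q` with `k ≤ l₁+l₂ ≤ 2q−k` and `|l₁−l₂| ≤ k`
(the sign `(−1)^{l₁+l₂−1}` is written as `−(−1)^{l₁+l₂}`). -/
noncomputable def dCoeff' (q k : ℕ) : ℝ :=
  ∑ l₁ ∈ range (q + 1), ∑ l₂ ∈ range (q + 1),
    if k ≤ l₁ + l₂ ∧ l₁ + l₂ + k ≤ 2 * q ∧ ((l₁ : ℤ) - (l₂ : ℤ)).natAbs ≤ k then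
      (2 * (q : ℝ) - (l₁ : ℝ) - (l₂ : ℝ) - (k : ℝ)) * (-((-1 : ℝ) ^ (l₁ + l₂))) *
        aCoeff q l₁ * aCoeff q l₂ * bCoeff q l₁ l₂ (l₁ + l₂ - k)
    else 0

open Polynomial in
/-- The linear functional on `ℝ[X]` sending `X ^ j` to `|j - q|`. -/
noncomputable def absMoment (q : ℕ) : ℝ[X] →ₗ[ℝ] ℝ :=
  Polynomial.lsum fun j => |(j : ℝ) - q| • LinearMap.id

open Polynomial in
theorem absMoment_X_pow (q j : ℕ) : absMoment q (X ^ j) = |(j : ℝ) - q| := by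
  rw [absMoment, Polynomial.lsum_apply, ← Polynomial.monomial_one_right_eq_X_pow,
    Polynomial.sum_monomial_index] <;> simp

open Polynomial in
theorem absMoment_succ_mul_X (q : ℕ) (p : ℝ[X]) : absMoment (q + 1) (X * p) = absMoment q p := by
  have h : (absMoment (q + 1)).comp (LinearMap.mulLeft ℝ (X : ℝ[X])) = absMoment q := by
    refine Polynomial.lhom_ext' fun n => LinearMap.ext_ring ?_
    simp only [LinearMap.comp_apply, LinearMap.mulLeft_apply,
      Polynomial.monomial_one_right_eq_X_pow, ← pow_succ', absMoment_X_pow]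
    push_cast
    congr 1
    ring
  exact LinearMap.congr_fun h p

open Polynomial in
theorem absMoment_mul_sub_one_sq (q : ℕ) (p : ℝ[X]) :
    absMoment (q + 1) ((X - 1) ^ 2 * p) = 2 * p.coeff q := by
  have h : (absMoment (q + 1)).comp (LinearMap.mulLeft ℝ ((X - 1) ^ 2 : ℝ[X])) =
      (2 : ℝ) • Polynomial.lcoeff ℝ q := by
    refine Polynomial.lhom_ext' fun n => LinearMap.ext_ring ?_
    have e : ((X - 1) ^ 2 * X ^ n : ℝ[X]) = X ^ (n + 2) - (2 : ℝ) • X ^ (n + 1) + X ^ n := by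
      rw [Polynomial.smul_eq_C_mul, map_ofNat]
      ring
    simp only [LinearMap.comp_apply, LinearMap.mulLeft_apply, LinearMap.smul_apply,
      Polynomial.monomial_one_right_eq_X_pow, e, map_add, map_sub, map_smul, absMoment_X_pow,
      Polynomial.lcoeff_apply, Polynomial.coeff_X_pow, smul_eq_mul]
    push_cast
    rcases lt_trichotomy n q with hn | rfl | hn
    · have : (n : ℝ) + 1 ≤ q := by exact_mod_cast hn
      rw [if_neg (by omega), abs_of_nonpos (by linarith), abs_of_nonpos (by linarith),
        abs_of_nonpos (by linarith)]
      ring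
    · rw [if_pos rfl, abs_of_nonneg (by linarith), abs_of_nonneg (by linarith),
        abs_of_nonpos (by linarith)]
      ring
    · have : (q : ℝ) + 1 ≤ n := by exact_mod_cast hn
      rw [if_neg (by omega), abs_of_nonneg (by linarith), abs_of_nonneg (by linarith),
        abs_of_nonneg (by linarith)]
      ring
  exact LinearMap.congr_fun h p

open Polynomial in
/-- `absMoment q` evaluated at `(X - 1) ^ m * (X + 1) ^ (2 * q - m)`. -/
noncomputable def binomMoment (q m : ℕ) : ℝ :=
  absMoment q ((X - 1) ^ m * (X + 1) ^ (2 * q - m))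

open Polynomial in
theorem binomMoment_succ_add_two {q m : ℕ} (hm : m ≤ 2 * q) :
    binomMoment (q + 1) (m + 2) = binomMoment (q + 1) m - 4 * binomMoment q m := by
  obtain ⟨r, hr⟩ := Nat.exists_eq_add_of_le hm
  have e₁ : 2 * (q + 1) - (m + 2) = r := by omega
  have e₂ : 2 * (q + 1) - m = r + 2 := by omega
  have e₃ : 2 * q - m = r := by omega
  have e : ((X - 1) ^ (m + 2) * (X + 1) ^ r : ℝ[X]) =
      (X - 1) ^ m * (X + 1) ^ (r + 2) - (4 : ℝ) • (X * ((X - 1) ^ m * (X + 1) ^ r)) := by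
    rw [Polynomial.smul_eq_C_mul, map_ofNat]
    ring
  rw [binomMoment, binomMoment, binomMoment, e₁, e₂, e₃, ← absMoment_succ_mul_X q, e, map_sub,
    map_smul, smul_eq_mul]

theorem binomMoment_zero (q : ℕ) : binomMoment q 0 = q * q.centralBinom := by
  induction q with
  | zero => simpa [binomMoment] using absMoment_X_pow 0 0
  | succ q ih =>
    have h₁ := binomMoment_succ_add_two (Nat.zero_le (2 * q))
    have h₂ : binomMoment (q + 1) 2 = 2 * q.centralBinom := by
      rw [binomMoment, absMoment_mul_sub_one_sq, Nat.mul_succ, Nat.add_sub_cancel,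
        Polynomial.coeff_X_add_one_pow, Nat.centralBinom]
    have h₃ : ((q + 1 : ℕ) : ℝ) * (q + 1).centralBinom = 2 * (2 * q + 1) * q.centralBinom := by
      exact_mod_cast Nat.succ_mul_centralBinom_succ q
    rw [zero_add, h₂, ih] at h₁
    linarith

theorem two_mul_natCast_sub_one_ne_zero (l : ℕ) : 2 * (l : ℝ) - 1 ≠ 0 := by
  intro h
  have : ((2 * l : ℕ) : ℝ) = (1 : ℕ) := by
    push_cast
    linarith
  have := Nat.cast_injective this
  omega

theorem factorial_two_mul_succ (n : ℕ) :
    ((2 * (n + 1)).factorial : ℝ) = (2 * n + 2) * (2 * n + 1) * (2 * n).factorial := by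
  rw [Nat.mul_succ, Nat.factorial_succ, Nat.factorial_succ]
  push_cast
  ring

theorem binomMoment_even (a b : ℕ) :
    binomMoment (a + b) (2 * a) =
      -((-1) ^ a * (a + b) / (a + b).factorial) *
        (aCoeff (a + b) a * (2 * a).factorial * (2 * b).factorial) := by
  induction a generalizing b with
  | zero =>
    have := Nat.factorial_ne_zero b
    simp only [zero_add, mul_zero, binomMoment_zero, aCoeff, Nat.centralBinom,
      Nat.choose_eq_factorial_div_factorial (Nat.le_mul_of_pos_left b two_pos)]
    rw [Nat.cast_div (Nat.factorial_mul_factorial_dvd_factorial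
      (Nat.le_mul_of_pos_left b two_pos)) (by positivity)]
    have e : 2 * b - b = b := by omega
    rw [e]
    push_cast
    simp
    field_simp
  | succ a ih =>
    have h := binomMoment_succ_add_two (q := a + b) (m := 2 * a) (by omega)
    have ih₁ := ih (b + 1)
    have ih₀ := ih b
    rw [← add_assoc] at ih₁
    rw [show a + 1 + b = a + b + 1 by ring, show 2 * (a + 1) = 2 * a + 2 by ring, h, ih₁, ih₀,
      ← Nat.mul_succ 2 a]
    have n₁ := two_mul_natCast_sub_one_ne_zero a
    have n₁' : (a : ℝ) * 2 - 1 ≠ 0 := by rwa [mul_comm]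
    have e : 2 * ((a : ℝ) + 1) - 1 = 2 * a + 1 := by ring
    have n₂ : 2 * (a : ℝ) + 1 ≠ 0 := by positivity
    have f₁ : (a.factorial : ℝ) ≠ 0 := by positivity
    have f₂ : (b.factorial : ℝ) ≠ 0 := by positivity
    have f₃ : ((a + b).factorial : ℝ) ≠ 0 := by positivity
    have f₄ : (a : ℝ) + b + 1 ≠ 0 := by positivity
    have f₅ : (b : ℝ) + 1 ≠ 0 := by positivity
    have f₆ : (a : ℝ) + 1 ≠ 0 := by positivity
    simp only [aCoeff, Nat.succ_eq_add_one, factorial_two_mul_succ,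
      show a + b + 1 - a = b + 1 by omega, show a + b - a = b by omega,
      show a + b + 1 - (a + 1) = b by omega, Nat.factorial_succ]
    push_cast
    rw [e]
    field_simp
    ring

open Polynomial in
theorem absMoment_eq_zero_of_reverse_eq_neg {q : ℕ} {p : ℝ[X]} (hd : p.natDegree = 2 * q)
    (hp : p.reverse = -p) : absMoment q p = 0 := by
  have e : absMoment q p = ∑ j ∈ range (2 * q + 1), p.coeff j * |(j : ℝ) - q| := by
    rw [absMoment, Polynomial.lsum_apply, Polynomial.sum_over_range' _ _ (2 * q + 1) (by omega)]
    · simp [mul_comm]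
    · simp
  have h : absMoment q p = -absMoment q p := by
    rw [e, ← Finset.sum_neg_distrib,
      ← Finset.sum_range_reflect (fun j => p.coeff j * |(j : ℝ) - q|)]
    refine Finset.sum_congr rfl fun j hj => ?_
    have hj' : j ≤ 2 * q := by simpa [Nat.lt_succ_iff] using hj
    have hc : p.coeff (2 * q - j) = -p.coeff j := by
      rw [← Polynomial.coeff_neg, ← hp, Polynomial.coeff_reverse, hd, Polynomial.revAt_le hj']
    rw [show 2 * q + 1 - 1 - j = 2 * q - j by omega, hc, Nat.cast_sub hj']
    push_cast
    rw [show 2 * (q : ℝ) - j - q = -(j - q) by ring, abs_neg]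
    ring
  linarith

open Polynomial in
theorem binomMoment_odd {q m : ℕ} (hm : Odd m) (hmq : m ≤ 2 * q) : binomMoment q m = 0 := by
  have d₁ : (X - 1 : ℝ[X]).natDegree = 1 := by simpa using natDegree_X_sub_C (1 : ℝ)
  have d₂ : (X + 1 : ℝ[X]).natDegree = 1 := by simpa using natDegree_X_add_C (1 : ℝ)
  have n₁ : (X - 1 : ℝ[X]) ≠ 0 := by simpa using X_sub_C_ne_zero (1 : ℝ)
  have n₂ : (X + 1 : ℝ[X]) ≠ 0 := by simpa using X_add_C_ne_zero (1 : ℝ)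
  have r₁ : (X - 1 : ℝ[X]).reverse = -(X - 1) := by
    rw [reverse, d₁, reflect_sub, reflect_one_X, reflect_one]
    simp
  have r₂ : (X + 1 : ℝ[X]).reverse = X + 1 := by
    rw [reverse, d₂, reflect_add, reflect_one_X, reflect_one]
    simp [add_comm]
  have rp : ∀ (p : ℝ[X]) (n : ℕ), (p ^ n).reverse = p.reverse ^ n := by
    intro p n
    induction n with
    | zero => simpa using reverse_C (1 : ℝ)
    | succ n ih => rw [pow_succ, reverse_mul_of_domain, ih, pow_succ]
  refine absMoment_eq_zero_of_reverse_eq_neg ?_ ?_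
  · rw [natDegree_mul (pow_ne_zero _ n₁) (pow_ne_zero _ n₂), natDegree_pow, natDegree_pow, d₁, d₂]
    omega
  · rw [reverse_mul_of_domain, rp, rp, r₁, r₂, hm.neg_pow, neg_mul]

open scoped TensorProduct in
open Polynomial in
/-- The functional `absMoment q ⊗ absMoment q` on `ℝ[X] ⊗ ℝ[X]`. -/
noncomputable def absMomentTensor (q : ℕ) : ℝ[X] ⊗[ℝ] ℝ[X] →ₗ[ℝ] ℝ :=
  LinearMap.mul' ℝ ℝ ∘ₗ TensorProduct.map (absMoment q) (absMoment q)

open scoped TensorProduct in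
open Polynomial in
theorem absMomentTensor_tmul (q : ℕ) (p r : ℝ[X]) :
    absMomentTensor q (p ⊗ₜ r) = absMoment q p * absMoment q r := by
  simp [absMomentTensor]

open scoped TensorProduct in
open Polynomial in
theorem absMomentTensor_diagonal (q : ℕ) (g : ℝ[X]) :
    absMomentTensor q (aeval (X ⊗ₜ X : ℝ[X] ⊗[ℝ] ℝ[X]) g * ((X + 1) ⊗ₜ (X + 1))) =
      4 * (derivative (derivative g)).eval 1 + (4 + 4 * (1 - 2 * (q : ℝ))) * (derivative g).eval 1 +
        (1 - 2 * (q : ℝ)) ^ 2 * g.eval 1 := by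
  have h : (absMomentTensor q).comp ((LinearMap.mulRight ℝ
        ((X + 1) ⊗ₜ (X + 1) : ℝ[X] ⊗[ℝ] ℝ[X])).comp
          (aeval (X ⊗ₜ X : ℝ[X] ⊗[ℝ] ℝ[X])).toLinearMap) =
      (4 : ℝ) • ((leval 1).comp (derivative.comp derivative)) +
        (4 + 4 * (1 - 2 * (q : ℝ))) • ((leval 1).comp derivative) +
        ((1 - 2 * (q : ℝ)) ^ 2) • (leval 1) := by
    refine Polynomial.lhom_ext' fun n => LinearMap.ext_ring ?_
    have e : absMoment q (X ^ n * (X + 1)) ^ 2 = (2 * (n : ℝ) + 1 - 2 * q) ^ 2 := by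
      rw [mul_add, ← pow_succ, mul_one, map_add, absMoment_X_pow, absMoment_X_pow]
      push_cast
      rcases lt_or_ge n q with hn | hn
      · have : (n : ℝ) + 1 ≤ q := by exact_mod_cast hn
        rw [abs_of_nonpos (by linarith), abs_of_nonpos (by linarith)]
        ring
      · have : (q : ℝ) ≤ n := by exact_mod_cast hn
        rw [abs_of_nonneg (by linarith), abs_of_nonneg (by linarith)]
        ring
    have hn : (n : ℝ) * ((n - 1 : ℕ) : ℝ) = n * (n - 1) := by
      cases n <;> simp
    simp only [LinearMap.comp_apply, LinearMap.mulRight_apply, AlgHom.toLinearMap_apply,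
      Polynomial.monomial_one_right_eq_X_pow, map_pow, aeval_X, Algebra.TensorProduct.tmul_pow,
      Algebra.TensorProduct.tmul_mul_tmul, absMomentTensor_tmul, ← pow_two, e,
      LinearMap.add_apply, LinearMap.smul_apply, leval_apply, smul_eq_mul, derivative_X_pow,
      derivative_C_mul, eval_mul, eval_C, eval_pow, eval_X, one_pow, mul_one, hn]
    ring
  exact LinearMap.congr_fun h g

open scoped TensorProduct in
open Polynomial in
theorem sum_choose_mul_binomMoment (q k N : ℕ) (hN : 2 * k + N + 1 = 2 * q) :
    ∑ i ∈ range (2 * k + 1), ∑ j ∈ range (N + 1),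
      ((2 * k).choose i : ℝ) * N.choose j *
        (binomMoment q (i + j) * binomMoment q (2 * k - i + j)) =
    2 ^ (2 * q - 1) * absMomentTensor q
      (aeval (X ⊗ₜ X : ℝ[X] ⊗[ℝ] ℝ[X]) ((X - 1) ^ (2 * k) * (X + 1) ^ N : ℝ[X]) *
        ((X + 1) ⊗ₜ (X + 1))) := by
  set s₁ : ℝ[X] ⊗[ℝ] ℝ[X] := (X - 1) ⊗ₜ 1 with hs₁
  set c₁ : ℝ[X] ⊗[ℝ] ℝ[X] := (X + 1) ⊗ₜ 1 with hc₁
  set s₂ : ℝ[X] ⊗[ℝ] ℝ[X] := 1 ⊗ₜ (X - 1) with hs₂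
  set c₂ : ℝ[X] ⊗[ℝ] ℝ[X] := 1 ⊗ₜ (X + 1) with hc₂
  have hX : (X ⊗ₜ X : ℝ[X] ⊗[ℝ] ℝ[X]) = (X ⊗ₜ 1) * (1 ⊗ₜ X) := by simp
  have hsmul : ∀ (c : ℝ) (x : ℝ[X] ⊗[ℝ] ℝ[X]), c • x = algebraMap ℝ _ c * x :=
    fun c x => Algebra.smul_def c x
  have hone : (1 ⊗ₜ 1 : ℝ[X] ⊗[ℝ] ℝ[X]) = 1 := rfl
  have e₁ : s₁ * c₂ + c₁ * s₂ = 2 * (X ⊗ₜ X - 1) := by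
    simp only [hs₁, hc₁, hs₂, hc₂, hX, TensorProduct.sub_tmul, TensorProduct.add_tmul,
      TensorProduct.tmul_sub, TensorProduct.tmul_add, hone]
    ring
  have e₂ : s₁ * s₂ + c₁ * c₂ = 2 * (X ⊗ₜ X + 1) := by
    simp only [hs₁, hc₁, hs₂, hc₂, hX, TensorProduct.sub_tmul, TensorProduct.add_tmul,
      TensorProduct.tmul_sub, TensorProduct.tmul_add, hone]
    ring
  have e₃ : c₁ * c₂ = (X + 1) ⊗ₜ (X + 1) := by simp [hc₁, hc₂]
  have key : (s₁ * c₂ + c₁ * s₂) ^ (2 * k) * (s₁ * s₂ + c₁ * c₂) ^ N * (c₁ * c₂) =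
      (2 ^ (2 * q - 1) : ℝ) •
        (aeval (X ⊗ₜ X : ℝ[X] ⊗[ℝ] ℝ[X]) ((X - 1) ^ (2 * k) * (X + 1) ^ N : ℝ[X]) *
        ((X + 1) ⊗ₜ (X + 1))) := by
    rw [e₁, e₂, e₃, show 2 * q - 1 = 2 * k + N by omega, hsmul, mul_pow, mul_pow]
    simp only [map_mul, map_pow, map_sub, map_add, map_one, aeval_X, map_ofNat]
    ring
  rw [← smul_eq_mul (2 ^ (2 * q - 1) : ℝ), ← map_smul (absMomentTensor q), ← key, add_pow,
    add_pow, Finset.sum_mul_sum, Finset.sum_mul, map_sum]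
  refine Finset.sum_congr rfl fun i hi => ?_
  rw [Finset.sum_mul, map_sum]
  refine Finset.sum_congr rfl fun j hj => ?_
  have hi' : i ≤ 2 * k := by simpa [Nat.lt_succ_iff] using hi
  have hj' : j ≤ N := by simpa [Nat.lt_succ_iff] using hj
  have e : (s₁ * c₂) ^ i * (c₁ * s₂) ^ (2 * k - i) * ((2 * k).choose i : ℝ[X] ⊗[ℝ] ℝ[X]) *
        ((s₁ * s₂) ^ j * (c₁ * c₂) ^ (N - j) * (N.choose j : ℝ[X] ⊗[ℝ] ℝ[X])) * (c₁ * c₂) =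
      (((2 * k).choose i : ℝ) * N.choose j) •
        (((X - 1) ^ (i + j) * (X + 1) ^ (2 * q - (i + j))) ⊗ₜ
          ((X - 1) ^ (2 * k - i + j) * (X + 1) ^ (2 * q - (2 * k - i + j)))) := by
    have t : (((X - 1) ^ (i + j) * (X + 1) ^ (2 * q - (i + j))) ⊗ₜ
          ((X - 1) ^ (2 * k - i + j) * (X + 1) ^ (2 * q - (2 * k - i + j))) :
            ℝ[X] ⊗[ℝ] ℝ[X]) =
        s₁ ^ (i + j) * c₁ ^ (2 * q - (i + j)) *
          (s₂ ^ (2 * k - i + j) * c₂ ^ (2 * q - (2 * k - i + j))) := by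
      simp [hs₁, hc₁, hs₂, hc₂, Algebra.TensorProduct.tmul_pow]
    rw [t, hsmul, map_mul, map_natCast, map_natCast,
      show 2 * q - (i + j) = (2 * k - i) + (N - j) + 1 by omega,
      show 2 * q - (2 * k - i + j) = i + (N - j) + 1 by omega]
    ring
  rw [e, map_smul, absMomentTensor_tmul, smul_eq_mul, binomMoment, binomMoment]

theorem dCoeff'_term (q k N l₁ l₂ : ℕ) (hN : 2 * k + N + 1 = 2 * q) (h₁ : k ≤ l₁ + l₂)
    (h₂ : l₁ + l₂ + k < 2 * q) (h₃ : l₁ ≤ l₂ + k) (h₄ : l₂ ≤ l₁ + k) :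
    ((2 * k).choose (k + l₁ - l₂) : ℝ) * N.choose (l₁ + l₂ - k) *
        (binomMoment q (2 * l₁) * binomMoment q (2 * l₂)) =
      -((q : ℝ) ^ 2 / (q.factorial : ℝ) ^ 2 * (2 * k).factorial * N.factorial) *
        ((2 * (q : ℝ) - (l₁ : ℝ) - (l₂ : ℝ) - (k : ℝ)) * (-((-1 : ℝ) ^ (l₁ + l₂))) *
          aCoeff q l₁ * aCoeff q l₂ * bCoeff q l₁ l₂ (l₁ + l₂ - k)) := by
  obtain ⟨m₁, rfl⟩ : ∃ m, q = l₁ + m := Nat.exists_eq_add_of_le (by omega)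
  obtain ⟨m₂, hm₂⟩ : ∃ m, l₁ + m₁ = l₂ + m := Nat.exists_eq_add_of_le (by omega)
  have H₁ := binomMoment_even l₁ m₁
  have H₂ := binomMoment_even l₂ m₂
  rw [← hm₂, show (l₂ : ℝ) + m₂ = l₁ + m₁ by exact_mod_cast hm₂.symm] at H₂
  obtain ⟨i, hi⟩ : ∃ i, i = k + l₁ - l₂ := ⟨_, rfl⟩
  obtain ⟨i', hi'⟩ : ∃ i, i = k + l₂ - l₁ := ⟨_, rfl⟩
  obtain ⟨j, hj⟩ : ∃ j, j = l₁ + l₂ - k := ⟨_, rfl⟩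
  obtain ⟨j', hj'⟩ : ∃ j', l₁ + l₂ + k + 1 + j' = 2 * (l₁ + m₁) :=
    (Nat.exists_eq_add_of_le (Nat.succ_le_of_lt h₂)).imp fun _ h => h.symm
  have hjr : 2 * ((l₁ + m₁ : ℕ) : ℝ) - l₁ - l₂ - k = j' + 1 := by
    have : (l₁ : ℝ) + l₂ + k + 1 + j' = 2 * ((l₁ + m₁ : ℕ) : ℝ) := by exact_mod_cast hj'
    linarith
  rw [H₁, H₂, hjr, bCoeff, ← hi, ← hj, show 2 * k = i + i' by omega, show N = j + j' by omega,
    Nat.cast_add_choose, Nat.cast_add_choose,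
    show 2 * (l₁ + m₁) + j - 2 * l₁ - 2 * l₂ = j' + 1 by omega,
    show 2 * l₁ - j = i by omega, show 2 * l₂ - j = i' by omega,
    show 2 * (l₁ + m₁) - 2 * l₁ = 2 * m₁ by omega,
    show 2 * (l₁ + m₁) - 2 * l₂ = 2 * m₂ by omega, Nat.factorial_succ j', pow_add]
  push_cast
  have : (i.factorial : ℝ) ≠ 0 := by positivity
  have : (i'.factorial : ℝ) ≠ 0 := by positivity
  have : (j.factorial : ℝ) ≠ 0 := by positivity
  have : (j'.factorial : ℝ) ≠ 0 := by positivity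
  have : (j' : ℝ) + 1 ≠ 0 := by positivity
  have : ((l₁ + m₁).factorial : ℝ) ≠ 0 := by positivity
  field_simp

theorem sum_choose_mul_binomMoment_eq_dCoeff' (q k N : ℕ) (hN : 2 * k + N + 1 = 2 * q) :
    ∑ i ∈ range (2 * k + 1), ∑ j ∈ range (N + 1),
      ((2 * k).choose i : ℝ) * N.choose j *
        (binomMoment q (i + j) * binomMoment q (2 * k - i + j)) =
    -((q : ℝ) ^ 2 / (q.factorial : ℝ) ^ 2 * (2 * k).factorial * N.factorial) * dCoeff' q k := by
  rw [dCoeff', Finset.mul_sum]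
  simp_rw [Finset.mul_sum]
  rw [← Finset.sum_product', ← Finset.sum_product']
  set K := -((q : ℝ) ^ 2 / (q.factorial : ℝ) ^ 2 * (2 * k).factorial * N.factorial)
  have hne : ∀ l₁ l₂ : ℕ, (K * if k ≤ l₁ + l₂ ∧ l₁ + l₂ + k ≤ 2 * q ∧
        ((l₁ : ℤ) - (l₂ : ℤ)).natAbs ≤ k then
      (2 * (q : ℝ) - (l₁ : ℝ) - (l₂ : ℝ) - (k : ℝ)) * (-((-1 : ℝ) ^ (l₁ + l₂))) *
        aCoeff q l₁ * aCoeff q l₂ * bCoeff q l₁ l₂ (l₁ + l₂ - k) else 0) ≠ 0 →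
      k ≤ l₁ + l₂ ∧ l₁ + l₂ + k < 2 * q ∧ l₁ ≤ l₂ + k ∧ l₂ ≤ l₁ + k := by
    intro l₁ l₂ h
    split_ifs at h with hc
    · have : l₁ + l₂ + k ≠ 2 * q := by
        intro h'
        have h'' : (l₁ : ℝ) + l₂ + k = 2 * q := by exact_mod_cast h'
        rw [show 2 * (q : ℝ) - l₁ - l₂ - k = 0 by linarith] at h
        simp at h
      omega
    · simp at h
  have hterm : ∀ l₁ l₂ : ℕ,
      k ≤ l₁ + l₂ → l₁ + l₂ + k < 2 * q → l₁ ≤ l₂ + k → l₂ ≤ l₁ + k →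
      (K * if k ≤ l₁ + l₂ ∧ l₁ + l₂ + k ≤ 2 * q ∧ ((l₁ : ℤ) - (l₂ : ℤ)).natAbs ≤ k then
      (2 * (q : ℝ) - (l₁ : ℝ) - (l₂ : ℝ) - (k : ℝ)) * (-((-1 : ℝ) ^ (l₁ + l₂))) *
        aCoeff q l₁ * aCoeff q l₂ * bCoeff q l₁ l₂ (l₁ + l₂ - k) else 0) =
      ((2 * k).choose (k + l₁ - l₂) : ℝ) * N.choose (l₁ + l₂ - k) *
        (binomMoment q (k + l₁ - l₂ + (l₁ + l₂ - k)) *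
          binomMoment q (2 * k - (k + l₁ - l₂) + (l₁ + l₂ - k))) := by
    intro l₁ l₂ h₁ h₂ h₃ h₄
    rw [if_pos (by omega), show k + l₁ - l₂ + (l₁ + l₂ - k) = 2 * l₁ by omega,
      show 2 * k - (k + l₁ - l₂) + (l₁ + l₂ - k) = 2 * l₂ by omega,
      dCoeff'_term q k N l₁ l₂ hN h₁ h₂ h₃ h₄]
  symm
  refine Finset.sum_bij_ne_zero
    (fun (x : ℕ × ℕ) _ _ => ((k + x.1 - x.2, x.1 + x.2 - k) : ℕ × ℕ)) ?_ ?_ ?_ ?_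
  · rintro ⟨l₁, l₂⟩ - h
    have := hne _ _ h
    simp only [Finset.mem_product, Finset.mem_range]
    omega
  · rintro ⟨l₁, l₂⟩ - h ⟨m₁, m₂⟩ - h' he
    have := hne _ _ h
    have := hne _ _ h'
    simp only [Prod.mk.injEq] at he ⊢
    omega
  · rintro ⟨i, j⟩ hij h
    simp only [Finset.mem_product, Finset.mem_range] at hij
    have he : Even (i + j) := by
      by_contra ho
      exact h (by simp [binomMoment_odd (Nat.not_even_iff_odd.1 ho) (by omega : i + j ≤ 2 * q)])
    obtain ⟨l₁, hl₁⟩ := he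
    obtain ⟨l₂, hl₂⟩ : ∃ l₂, l₂ = k + j - l₁ := ⟨_, rfl⟩
    have hi : k + l₁ - l₂ = i := by omega
    have hj : l₁ + l₂ - k = j := by omega
    refine ⟨(l₁, l₂), ?_, ?_, ?_⟩
    · simp only [Finset.mem_product, Finset.mem_range]
      omega
    · have ht := hterm l₁ l₂ (by omega) (by omega) (by omega) (by omega)
      refine ht.trans_ne ?_
      rwa [hi, hj]
    · simp only [Prod.mk.injEq]
      omega
  · rintro ⟨l₁, l₂⟩ - h
    obtain ⟨h₁, h₂, h₃, h₄⟩ := hne _ _ h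
    exact hterm l₁ l₂ h₁ h₂ h₃ h₄

theorem dCoeff'_eq_zero_of_le {q k : ℕ} (h : q ≤ k) : dCoeff' q k = 0 := by
  refine Finset.sum_eq_zero fun l₁ _ => Finset.sum_eq_zero fun l₂ _ => ?_
  split_ifs with hc
  · have : (l₁ : ℝ) + l₂ + k = 2 * q := by
      have : l₁ + l₂ + k = 2 * q := by omega
      exact_mod_cast this
    rw [show 2 * (q : ℝ) - l₁ - l₂ - k = 0 by linarith]
    simp
  · rfl

open Polynomial in
theorem factorial_mul_dCoeff' (q k N : ℕ) (hN : 2 * k + N + 1 = 2 * q) :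
    -((q : ℝ) ^ 2 / (q.factorial : ℝ) ^ 2 * (2 * k).factorial * N.factorial) * dCoeff' q k =
      2 ^ (2 * q - 1) *
        (4 * (derivative (derivative ((X - 1) ^ (2 * k) * (X + 1) ^ N : ℝ[X]))).eval 1 +
          (4 + 4 * (1 - 2 * (q : ℝ))) *
            (derivative ((X - 1) ^ (2 * k) * (X + 1) ^ N : ℝ[X])).eval 1 +
          (1 - 2 * (q : ℝ)) ^ 2 * ((X - 1) ^ (2 * k) * (X + 1) ^ N : ℝ[X]).eval 1) := by
  rw [← sum_choose_mul_binomMoment_eq_dCoeff' q k N hN, sum_choose_mul_binomMoment q k N hN,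
    absMomentTensor_diagonal]

theorem dCoeff'_of_two_le {q k : ℕ} (hq : 1 ≤ q) (hk : 2 ≤ k) : dCoeff' q k = 0 := by
  rcases le_or_gt q k with h | h
  · exact dCoeff'_eq_zero_of_le h
  obtain ⟨N, hN⟩ : ∃ N, 2 * k + N + 1 = 2 * q := ⟨2 * q - 2 * k - 1, by omega⟩
  have key := factorial_mul_dCoeff' q k N hN
  obtain ⟨m, hm⟩ : ∃ m, 2 * k = m + 3 := ⟨2 * k - 3, by omega⟩
  have hz : ((q : ℝ) ^ 2 / (q.factorial : ℝ) ^ 2 * (2 * k).factorial * N.factorial) ≠ 0 := by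
    positivity
  refine (mul_eq_zero.1 (key.trans ?_)).resolve_left (neg_ne_zero.2 hz)
  rw [hm]
  simp [Polynomial.derivative_mul, Polynomial.derivative_pow]

theorem dCoeff'_one {q : ℕ} (hq : 1 ≤ q) :
    dCoeff' q 1 = -((2 * (q : ℝ) - 1) * (2 * (q : ℝ) - 2) * cCoeff q) := by
  rcases hq.eq_or_lt with rfl | h
  · rw [dCoeff'_eq_zero_of_le le_rfl]
    norm_num
  obtain ⟨r, rfl⟩ : ∃ r, q = r + 2 := ⟨q - 2, by omega⟩
  have key := factorial_mul_dCoeff' (r + 2) 1 (2 * r + 1) (by ring)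
  have hf : ((2 * (r + 2)).factorial : ℝ) =
      (2 * r + 4) * (2 * r + 3) * (2 * r + 2) * (2 * r + 1).factorial := by
    rw [show 2 * (r + 2) = 2 * r + 1 + 1 + 1 + 1 by ring, Nat.factorial_succ, Nat.factorial_succ,
      Nat.factorial_succ]
    push_cast
    ring
  rw [show 2 * (r + 2) - 1 = 2 * r + 3 by omega] at key
  simp [Polynomial.derivative_mul, Polynomial.derivative_pow] at key
  rw [cCoeff, hf]
  have : ((r + 2).factorial : ℝ) ≠ 0 := by positivity
  have : ((2 * r + 1).factorial : ℝ) ≠ 0 := by positivity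
  push_cast
  field_simp at key ⊢
  linear_combination -4 * (2 * (r : ℝ) + 3) * (r + 1) * key

theorem dCoeff'_zero {q : ℕ} (hq : 1 ≤ q) :
    dCoeff' q 0 = -((2 * (q : ℝ) - 1) * cCoeff q) := by
  obtain ⟨r, rfl⟩ : ∃ r, q = r + 1 := ⟨q - 1, by omega⟩
  have key := factorial_mul_dCoeff' (r + 1) 0 (2 * r + 1) (by ring)
  have hf : ((2 * (r + 1)).factorial : ℝ) = (2 * r + 2) * (2 * r + 1).factorial := by
    rw [Nat.mul_succ, Nat.factorial_succ]
    push_cast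
    ring
  rw [show 2 * (r + 1) - 1 = 2 * r + 1 by omega] at key
  simp [Polynomial.derivative_mul, Polynomial.derivative_pow] at key
  rw [cCoeff, hf]
  have : ((r + 1).factorial : ℝ) ≠ 0 := by positivity
  have : ((2 * r + 1).factorial : ℝ) ≠ 0 := by positivity
  push_cast
  field_simp at key ⊢
  have hp : (r : ℝ) * 2 * (1 + 1) ^ (2 * r - 1) = r * (1 + 1) ^ (2 * r) := by
    rcases r with _ | r
    · simp
    · rw [show 2 * (r + 1) - 1 = 2 * r + 1 by omega]
      ring
  rw [hp] at key
  linear_combination -4 * key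

/-- For every `q ≥ 1`: `d'_q(k) = 0` for all `k ≥ 2`, `d'_q(1) = −(2q−1)(2q−2)c_q`, and
`d'_q(0) = −(2q−1)c_q`. -/
theorem dCoeff'_values (q : ℕ) (hq : 1 ≤ q) :
    (∀ k : ℕ, 2 ≤ k → dCoeff' q k = 0) ∧
    dCoeff' q 1 = -((2 * (q : ℝ) - 1) * (2 * (q : ℝ) - 2) * cCoeff q) ∧
    dCoeff' q 0 = -((2 * (q : ℝ) - 1) * cCoeff q) := by
  exact ⟨fun _ hk => dCoeff'_of_two_le hq hk, dCoeff'_one hq, dCoeff'_zero hq⟩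
end

section
/- For every integer q ≥ 1 and every integer k ≥ 0 with k ≠ q+2, the following recurrence holds: 32 q² · d_q(k) + 4(4kq − 4q² + 2k − 7q − 4) · d_{q+1}(k) + (2k−2q−3)(k−q−2) · d_{q+2}(k) = 0. -/
open Finset

/-- `d_q(k) = Σ (−1)^{l₁+l₂} a_q(l₁) a_q(l₂) b_q(l₁,l₂,l₁+l₂−k)`, summed over pairs
`0 ≤ l₁,l₂ ≤ q` with `k ≤ l₁+l₂ ≤ 2q−k` and `|l₁−l₂| ≤ k`. -/
noncomputable def dCoeff (q k : ℕ) : ℝ :=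
  ∑ l₁ ∈ range (q + 1), ∑ l₂ ∈ range (q + 1),
    if k ≤ l₁ + l₂ ∧ l₁ + l₂ + k ≤ 2 * q ∧ ((l₁ : ℤ) - (l₂ : ℤ)).natAbs ≤ k then
      (-1 : ℝ) ^ (l₁ + l₂) * aCoeff q l₁ * aCoeff q l₂ * bCoeff q l₁ l₂ (l₁ + l₂ - k)
    else 0

/-- The normalized beta value `Γ(l - 1/2) Γ(q - l + 1/2) / (π Γ(q))`. -/
noncomputable def betaMoment (q l : ℕ) : ℝ :=
  Real.Gamma ((l : ℝ) - 1 / 2) * Real.Gamma ((q : ℝ) - l + 1 / 2) / (Real.pi * Real.Gamma q)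

/-- The sequence of moments supported on even indices, given there by `betaMoment`. -/
noncomputable def evenMoment (q i : ℕ) : ℝ := if Even i then betaMoment q (i / 2) else 0

/-- The functional on bivariate polynomials with product moments `evenMoment`. -/
noncomputable def momentFunctional (q : ℕ) : MvPolynomial (Fin 2) ℝ →ₗ[ℝ] ℝ :=
  (MvPolynomial.basisMonomials (Fin 2) ℝ).constr ℝ fun s => evenMoment q (s 0) * evenMoment q (s 1)

/-- The value of `momentFunctional` at `(x + y)^(2k) (1 - xy)^(2m)`, of degree `q = k + m`. -/
noncomputable def tangentMoment (k m : ℕ) : ℝ :=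
  momentFunctional (k + m)
    ((MvPolynomial.X 0 + MvPolynomial.X 1) ^ (2 * k) *
      (1 - MvPolynomial.X 0 * MvPolynomial.X 1) ^ (2 * m))

theorem nat_sub_half_ne_zero (l : ℕ) : (l : ℝ) - 1 / 2 ≠ 0 := by
  intro h
  have h2 : (2 * l : ℝ) = 1 := by linarith
  have h3 : 2 * l = 1 := by exact_mod_cast h2
  omega

theorem betaMoment_add (q l : ℕ) (hq : 1 ≤ q) :
    betaMoment (q + 1) l + betaMoment (q + 1) (l + 1) = betaMoment q l := by
  have h1 : (q : ℝ) - l + 1 / 2 ≠ 0 := by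
    intro h
    have h2 : (2 * q + 1 : ℝ) = 2 * l := by linarith
    have h3 : 2 * q + 1 = 2 * l := by exact_mod_cast h2
    omega
  have hq0 : (q : ℝ) ≠ 0 := by positivity
  have hG : Real.Gamma q ≠ 0 := (Real.Gamma_pos_of_pos (by positivity)).ne'
  have e1 := Real.Gamma_add_one h1
  have e2 := Real.Gamma_add_one (nat_sub_half_ne_zero l)
  have e3 := Real.Gamma_add_one hq0
  unfold betaMoment
  push_cast
  rw [show (q : ℝ) + 1 - l + 1 / 2 = q - l + 1 / 2 + 1 by ring,
    show (l : ℝ) + 1 - 1 / 2 = l - 1 / 2 + 1 by ring,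
    show (q : ℝ) + 1 - (l + 1) + 1 / 2 = q - l + 1 / 2 by ring, e1, e2, e3]
  field_simp
  ring

theorem evenMoment_add (q i : ℕ) (hq : 1 ≤ q) :
    evenMoment (q + 1) i + evenMoment (q + 1) (i + 2) = evenMoment q i := by
  unfold evenMoment
  have h : Even (i + 2) ↔ Even i := by simp [Nat.even_add]
  by_cases hi : Even i
  · simp [h, hi, betaMoment_add q (i / 2) hq]
  · simp [h, hi]

theorem momentFunctional_X_pow_mul (q i j : ℕ) :
    momentFunctional q (MvPolynomial.X 0 ^ i * MvPolynomial.X 1 ^ j) =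
      evenMoment q i * evenMoment q j := by
  have h : (MvPolynomial.X 0 ^ i * MvPolynomial.X 1 ^ j : MvPolynomial (Fin 2) ℝ) =
      MvPolynomial.basisMonomials (Fin 2) ℝ (Finsupp.single 0 i + Finsupp.single 1 j) := by
    simp [MvPolynomial.X_pow_eq_monomial, MvPolynomial.monomial_mul]
  rw [momentFunctional, h, Module.Basis.constr_basis]
  simp

theorem momentFunctional_succ (q : ℕ) (hq : 1 ≤ q) (p : MvPolynomial (Fin 2) ℝ) :
    momentFunctional (q + 1)
      ((1 + MvPolynomial.X 0 ^ 2) * (1 + MvPolynomial.X 1 ^ 2) * p) = momentFunctional q p := by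
  induction p using MvPolynomial.induction_on' with
  | monomial s a =>
    have h : MvPolynomial.monomial s a =
        a • (MvPolynomial.X 0 ^ s 0 * MvPolynomial.X 1 ^ s 1 : MvPolynomial (Fin 2) ℝ) := by
      rw [MvPolynomial.monomial_eq, Finsupp.prod_fintype _ _ (by simp), Fin.prod_univ_two,
        MvPolynomial.smul_eq_C_mul]
    rw [h, mul_smul_comm, map_smul, map_smul]
    congr 1
    rw [momentFunctional_X_pow_mul, ← evenMoment_add q (s 0) hq, ← evenMoment_add q (s 1) hq]
    rw [show (1 + MvPolynomial.X 0 ^ 2) * (1 + MvPolynomial.X 1 ^ 2) *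
        (MvPolynomial.X 0 ^ s 0 * MvPolynomial.X 1 ^ s 1 : MvPolynomial (Fin 2) ℝ) =
        MvPolynomial.X 0 ^ s 0 * MvPolynomial.X 1 ^ s 1 +
        MvPolynomial.X 0 ^ (s 0 + 2) * MvPolynomial.X 1 ^ s 1 +
        MvPolynomial.X 0 ^ s 0 * MvPolynomial.X 1 ^ (s 1 + 2) +
        MvPolynomial.X 0 ^ (s 0 + 2) * MvPolynomial.X 1 ^ (s 1 + 2) by ring]
    simp only [map_add, momentFunctional_X_pow_mul]
    ring
  | add p r hp hr => rw [mul_add, map_add, hp, hr, map_add]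

theorem tangentMoment_add (k m : ℕ) (h : 1 ≤ k + m) :
    tangentMoment k (m + 1) + tangentMoment (k + 1) m = tangentMoment k m := by
  unfold tangentMoment
  rw [← momentFunctional_succ (k + m) h, ← add_assoc, show k + 1 + m = k + m + 1 by ring, ← map_add]
  congr 1
  ring

theorem tangentMoment_eq_sum (k m : ℕ) :
    tangentMoment k m = ∑ b ∈ range (2 * k + 1), ∑ d ∈ range (2 * m + 1),
      (-1) ^ d * ((2 * k).choose b : ℝ) * ((2 * m).choose d : ℝ) *
        (evenMoment (k + m) (b + d) * evenMoment (k + m) (2 * k - b + d)) := by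
  unfold tangentMoment
  rw [add_pow, show (1 - MvPolynomial.X 0 * MvPolynomial.X 1 : MvPolynomial (Fin 2) ℝ) =
    -(MvPolynomial.X 0 * MvPolynomial.X 1) + 1 by ring, add_pow, sum_mul_sum, map_sum]
  refine sum_congr rfl fun b _ => ?_
  rw [map_sum]
  refine sum_congr rfl fun d _ => ?_
  rw [← momentFunctional_X_pow_mul, ← smul_eq_mul (_ * _ * _ : ℝ), ← map_smul]
  congr 1
  rw [MvPolynomial.smul_eq_C_mul]
  simp only [map_mul, map_pow, map_neg, map_one, map_natCast]
  rw [neg_pow (MvPolynomial.X 0 * MvPolynomial.X 1)]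
  ring

theorem Gamma_nat_add_half_eq_factorial (n : ℕ) :
    Real.Gamma ((n : ℝ) + 1 / 2) =
      ((2 * n).factorial : ℝ) / (4 ^ n * (n.factorial : ℝ)) * √Real.pi := by
  induction n with
  | zero => simpa using Real.Gamma_one_half_eq
  | succ n ih =>
    rw [show ((n + 1 : ℕ) : ℝ) + 1 / 2 = (n : ℝ) + 1 / 2 + 1 by push_cast; ring,
      Real.Gamma_add_one (by positivity), ih, show 2 * (n + 1) = 2 * n + 1 + 1 by ring,
      Nat.factorial_succ, Nat.factorial_succ, Nat.factorial_succ n]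
    push_cast
    field_simp
    ring

theorem betaMoment_eq_factorial (q l : ℕ) (hq : 1 ≤ q) (hl : l ≤ q) :
    betaMoment q l = 2 * ((2 * l).factorial : ℝ) * ((2 * q - 2 * l).factorial : ℝ) /
      (4 ^ q * (l.factorial : ℝ) * ((q - l).factorial : ℝ) * (2 * (l : ℝ) - 1) *
        ((q - 1).factorial : ℝ)) := by
  obtain ⟨n, rfl⟩ := Nat.exists_eq_add_of_le hl
  have hl0 := nat_sub_half_ne_zero l
  have hl1 : 2 * (l : ℝ) - 1 ≠ 0 := fun h => hl0 (by linarith)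
  have e1 := Real.Gamma_add_one hl0
  rw [show (l : ℝ) - 1 / 2 + 1 = l + 1 / 2 by ring, Gamma_nat_add_half_eq_factorial] at e1
  have e2 : Real.Gamma ((l : ℝ) - 1 / 2) =
      2 * (((2 * l).factorial : ℝ) / (4 ^ l * (l.factorial : ℝ)) * √Real.pi) / (2 * l - 1) := by
    rw [e1, eq_div_iff hl1]
    ring
  have e3 : Real.Gamma ((l + n : ℕ) : ℝ) = ((l + n - 1).factorial : ℝ) := by
    obtain ⟨r, hr⟩ := Nat.exists_eq_add_of_le' hq
    rw [hr, Nat.add_sub_cancel]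
    push_cast
    exact Real.Gamma_nat_eq_factorial r
  unfold betaMoment
  rw [e3, e2, show ((l + n : ℕ) : ℝ) - l + 1 / 2 = n + 1 / 2 by push_cast; ring,
    Gamma_nat_add_half_eq_factorial, Nat.add_sub_cancel_left,
    show 2 * (l + n) - 2 * l = 2 * n by omega]
  have hpi : √Real.pi * √Real.pi = Real.pi := Real.mul_self_sqrt Real.pi_pos.le
  have hp := Real.pi_pos
  rw [div_mul_eq_mul_div, div_div, div_eq_div_iff (by positivity) (by positivity)]
  field_simp
  rw [pow_add]
  linear_combination (4 : ℝ) ^ l * 4 ^ n * hpi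

theorem aCoeff_mul_bCoeff_eq (k m l₁ l₂ b d : ℕ) (hq : 1 ≤ k + m) (hb : b + l₂ = k + l₁)
    (hd : d + k = l₁ + l₂) (hbk : b ≤ 2 * k) (hdm : d ≤ 2 * m) :
    (-1 : ℝ) ^ (l₁ + l₂) * aCoeff (k + m) l₁ * aCoeff (k + m) l₂ *
        bCoeff (k + m) l₁ l₂ (l₁ + l₂ - k) =
      (-1) ^ k * 16 ^ (k + m) * ((k + m - 1).factorial : ℝ) ^ 2 /
        (4 * ((2 * k).factorial : ℝ) * ((2 * m).factorial : ℝ)) *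
      ((-1) ^ d * ((2 * k).choose b : ℝ) * ((2 * m).choose d : ℝ) *
        (betaMoment (k + m) l₁ * betaMoment (k + m) l₂)) := by
  have hl₁ : l₁ ≤ k + m := by omega
  have hl₂ : l₂ ≤ k + m := by omega
  rw [betaMoment_eq_factorial _ _ hq hl₁, betaMoment_eq_factorial _ _ hq hl₂,
    Nat.cast_choose ℝ hbk, Nat.cast_choose ℝ hdm, ← hd, Nat.add_sub_cancel]
  unfold aCoeff bCoeff
  rw [show 2 * (k + m) + d - 2 * l₁ - 2 * l₂ = 2 * m - d by omega,
    show 2 * l₁ - d = b by omega, show 2 * l₂ - d = 2 * k - b by omega, pow_add (-1 : ℝ),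
    show (16 : ℝ) ^ (k + m) = 4 ^ (k + m) * 4 ^ (k + m) by rw [← mul_pow]; norm_num]
  have h1 : 2 * (l₁ : ℝ) - 1 ≠ 0 := fun h => nat_sub_half_ne_zero l₁ (by linarith)
  have h2 : 2 * (l₂ : ℝ) - 1 ≠ 0 := fun h => nat_sub_half_ne_zero l₂ (by linarith)
  field_simp
  ring

theorem dCoeff_add_eq (k m : ℕ) (hq : 1 ≤ k + m) :
    dCoeff (k + m) k = (-1) ^ k * 16 ^ (k + m) * ((k + m - 1).factorial : ℝ) ^ 2 /
        (4 * ((2 * k).factorial : ℝ) * ((2 * m).factorial : ℝ)) * tangentMoment k m := by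
  rw [tangentMoment_eq_sum, dCoeff, mul_sum]
  simp_rw [mul_sum]
  rw [← sum_product', ← sum_product', ← sum_filter]
  have hs : ∀ x ∈ range (2 * k + 1) ×ˢ range (2 * m + 1), ¬ Even (x.1 + x.2) →
      (-1) ^ k * 16 ^ (k + m) * ((k + m - 1).factorial : ℝ) ^ 2 /
        (4 * ((2 * k).factorial : ℝ) * ((2 * m).factorial : ℝ)) *
      ((-1) ^ x.2 * ((2 * k).choose x.1 : ℝ) * ((2 * m).choose x.2 : ℝ) *
        (evenMoment (k + m) (x.1 + x.2) * evenMoment (k + m) (2 * k - x.1 + x.2))) = 0 := by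
    intro x _ hx
    simp [evenMoment, hx]
  rw [← sum_filter_of_ne (s := range (2 * k + 1) ×ˢ range (2 * m + 1))
      (p := fun x => Even (x.1 + x.2)) fun x hx h => by
    by_contra hne
    exact h (hs x hx hne)]
  refine sum_bij' (fun x _ => (k + x.1 - x.2, x.1 + x.2 - k))
    (fun x _ => ((x.1 + x.2) / 2, (2 * k - x.1 + x.2) / 2)) ?_ ?_ ?_ ?_ ?_
  · rintro ⟨l₁, l₂⟩ h
    simp only [mem_filter, mem_product, mem_range, Nat.even_iff] at h ⊢
    omega
  · rintro ⟨b, d⟩ h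
    simp only [mem_filter, mem_product, mem_range, Nat.even_iff] at h ⊢
    omega
  · rintro ⟨l₁, l₂⟩ h
    simp only [mem_filter, mem_product, mem_range, Prod.mk.injEq] at h ⊢
    omega
  · rintro ⟨b, d⟩ h
    simp only [mem_filter, mem_product, mem_range, Nat.even_iff, Prod.mk.injEq] at h ⊢
    omega
  · rintro ⟨l₁, l₂⟩ h
    simp only [mem_filter, mem_product, mem_range] at h ⊢
    rw [aCoeff_mul_bCoeff_eq k m l₁ l₂ (k + l₁ - l₂) (l₁ + l₂ - k) hq (by omega) (by omega)
      (by omega) (by omega)]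
    rw [show k + l₁ - l₂ + (l₁ + l₂ - k) = 2 * l₁ by omega,
      show 2 * k - (k + l₁ - l₂) + (l₁ + l₂ - k) = 2 * l₂ by omega]
    simp [evenMoment]

theorem dCoeff_eq_zero_of_lt (q k : ℕ) (h : q < k) : dCoeff q k = 0 := by
  unfold dCoeff
  refine sum_eq_zero fun l₁ _ => sum_eq_zero fun l₂ _ => if_neg ?_
  omega

theorem centralBinom_succ_eq_catalan (l : ℕ) :
    ((l + 1).centralBinom : ℝ) / (2 * ((l + 1 : ℕ) : ℝ) - 1) = 2 * (catalan l : ℝ) := by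
  have h1 : ((l : ℝ) + 1) * (l + 1).centralBinom = 2 * (2 * l + 1) * l.centralBinom := by
    exact_mod_cast Nat.succ_mul_centralBinom_succ l
  have h2 : ((l : ℝ) + 1) * catalan l = l.centralBinom := by
    exact_mod_cast succ_mul_catalan_eq_centralBinom l
  have h3 : (l : ℝ) + 1 ≠ 0 := by positivity
  have h4 : 2 * (l : ℝ) + 1 ≠ 0 := by positivity
  push_cast
  rw [show 2 * ((l : ℝ) + 1) - 1 = 2 * l + 1 by ring, div_eq_iff h4]
  apply mul_left_cancel₀ h3
  linear_combination h1 - 2 * (2 * l + 1) * h2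

/-- The coefficients of the square of `√(1 - 4x)` vanish from degree two on. -/
theorem sum_centralBinom_div_mul_eq_zero (n : ℕ) :
    ∑ l ∈ range (n + 2 + 1), ((l.centralBinom : ℝ) / (2 * (l : ℝ) - 1)) *
      (((n + 2 - l).centralBinom : ℝ) / (2 * ((n + 2 - l : ℕ) : ℝ) - 1)) = 0 := by
  rw [sum_range_succ, sum_range_succ']
  have hc : (catalan (n + 1) : ℝ) = ∑ l ∈ range (n + 1), (catalan l : ℝ) * catalan (n - l) := by
    rw [catalan_succ, Finset.sum_range]
    push_cast
    rfl
  have hs : ∑ l ∈ range (n + 1), (((l + 1).centralBinom : ℝ) / (2 * ((l + 1 : ℕ) : ℝ) - 1)) *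
      (((n + 2 - (l + 1)).centralBinom : ℝ) / (2 * ((n + 2 - (l + 1) : ℕ) : ℝ) - 1)) =
      4 * (catalan (n + 1) : ℝ) := by
    rw [hc, mul_sum]
    refine sum_congr rfl fun l hl => ?_
    have hl' := mem_range.1 hl
    rw [show n + 2 - (l + 1) = n - l + 1 by omega, centralBinom_succ_eq_catalan,
      centralBinom_succ_eq_catalan]
    ring
  rw [hs, Nat.sub_zero, Nat.sub_self, centralBinom_succ_eq_catalan]
  simp
  ring

theorem centralBinom_eq_factorial_div (l : ℕ) :
    (l.centralBinom : ℝ) = ((2 * l).factorial : ℝ) / ((l.factorial : ℝ) * (l.factorial : ℝ)) := by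
  rw [Nat.centralBinom_eq_two_mul_choose, Nat.cast_choose ℝ (by omega),
    show 2 * l - l = l by omega]

theorem dCoeff_self (q : ℕ) :
    dCoeff q q = (-1) ^ q *
      ∑ l ∈ range (q + 1), ((l.centralBinom : ℝ) / (2 * (l : ℝ) - 1)) *
        (((q - l).centralBinom : ℝ) / (2 * ((q - l : ℕ) : ℝ) - 1)) := by
  unfold dCoeff
  rw [mul_sum]
  refine sum_congr rfl fun l hl => ?_
  have hl' := mem_range.1 hl
  rw [sum_eq_single (q - l)]
  · rw [if_pos (by omega)]
    obtain ⟨n, rfl⟩ := Nat.exists_eq_add_of_le (Nat.le_of_lt_succ hl')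
    unfold aCoeff bCoeff
    rw [Nat.add_sub_cancel_left, Nat.sub_self, Nat.add_sub_cancel,
      show 2 * (l + n) + 0 - 2 * l - 2 * n = 0 by omega,
      show 2 * (l + n) - 2 * l = 2 * n by omega, show 2 * (l + n) - 2 * n = 2 * l by omega,
      centralBinom_eq_factorial_div, centralBinom_eq_factorial_div]
    have h1 : 2 * (l : ℝ) - 1 ≠ 0 := fun h => nat_sub_half_ne_zero l (by linarith)
    have h2 : 2 * (n : ℝ) - 1 ≠ 0 := fun h => nat_sub_half_ne_zero n (by linarith)
    simp only [Nat.factorial_zero, Nat.cast_one, Nat.sub_zero]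
    field_simp
  · intro l₂ _ hne
    exact if_neg (by omega)
  · intro h
    exact absurd (mem_range.2 (by omega)) h

theorem tangentMoment_eq_zero (k m : ℕ) (hk : 2 ≤ k) : tangentMoment k m = 0 := by
  induction m generalizing k with
  | zero =>
    obtain ⟨n, rfl⟩ := Nat.exists_eq_add_of_le' hk
    have h := dCoeff_add_eq (n + 2) 0 (by omega)
    rw [add_zero, dCoeff_self, sum_centralBinom_div_mul_eq_zero, mul_zero] at h
    refine (mul_eq_zero.1 h.symm).resolve_left ?_
    positivity
  | succ m ih =>
    have h := tangentMoment_add k m (by omega)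
    rw [ih k hk, ih (k + 1) (by omega)] at h
    linarith

theorem tangentMoment_one (m : ℕ) : tangentMoment 1 m = -2 := by
  induction m with
  | zero =>
    have h := dCoeff_add_eq 1 0 le_rfl
    rw [add_zero, dCoeff_self] at h
    norm_num [sum_range_succ, Nat.centralBinom, Nat.choose, Nat.factorial] at h
    linarith
  | succ m ih =>
    have h := tangentMoment_add 1 m (by omega)
    rw [ih, tangentMoment_eq_zero 2 m le_rfl] at h
    linarith

theorem tangentMoment_zero (m : ℕ) : tangentMoment 0 (m + 1) = 2 * ((m : ℝ) + 1) := by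
  induction m with
  | zero =>
    have h := dCoeff_add_eq 0 1 le_rfl
    norm_num [dCoeff, aCoeff, bCoeff, sum_range_succ, Nat.factorial] at h
    norm_num
    linarith
  | succ m ih =>
    have h := tangentMoment_add 0 (m + 1) (by omega)
    rw [ih, zero_add, tangentMoment_one] at h
    push_cast
    linarith

theorem dCoeff_eq_zero_of_two_le (q k : ℕ) (hk : 2 ≤ k) : dCoeff q k = 0 := by
  rcases lt_or_ge q k with h | h
  · exact dCoeff_eq_zero_of_lt q k h
  · obtain ⟨m, rfl⟩ := Nat.exists_eq_add_of_le h
    rw [dCoeff_add_eq k m (by omega), tangentMoment_eq_zero k m hk, mul_zero]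

theorem dCoeff_succ_one (n : ℕ) :
    dCoeff (n + 1) 1 = 16 ^ (n + 1) * (n.factorial : ℝ) ^ 2 / (4 * ((2 * n).factorial : ℝ)) := by
  rw [add_comm n 1, dCoeff_add_eq 1 n (by omega), tangentMoment_one, Nat.add_sub_cancel_left]
  norm_num [Nat.factorial]
  field_simp
  norm_num

theorem dCoeff_succ_zero (n : ℕ) :
    dCoeff (n + 1) 0 = 16 ^ (n + 1) * (n.factorial : ℝ) ^ 2 * (n + 1) /
      (2 * ((2 * (n + 1)).factorial : ℝ)) := by
  have h := dCoeff_add_eq 0 (n + 1) (by omega)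
  rw [zero_add, tangentMoment_zero, Nat.add_sub_cancel] at h
  rw [h, mul_zero, Nat.factorial_zero]
  push_cast
  field_simp
  norm_num

/-- For every `q ≥ 1` and `k ≥ 0` with `k ≠ q + 2`:
`32q²·d_q(k) + 4(4kq − 4q² + 2k − 7q − 4)·d_{q+1}(k) + (2k−2q−3)(k−q−2)·d_{q+2}(k) = 0`. -/
theorem dCoeff_recurrence (q k : ℕ) (hq : 1 ≤ q) (hk : k ≠ q + 2) :
    32 * (q : ℝ) ^ 2 * dCoeff q k +
      4 * (4 * (k : ℝ) * (q : ℝ) - 4 * (q : ℝ) ^ 2 + 2 * (k : ℝ) - 7 * (q : ℝ) - 4) *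
        dCoeff (q + 1) k +
      (2 * (k : ℝ) - 2 * (q : ℝ) - 3) * ((k : ℝ) - (q : ℝ) - 2) * dCoeff (q + 2) k = 0 := by
  rcases lt_or_ge k 2 with h | h
  · obtain ⟨n, rfl⟩ := Nat.exists_eq_add_of_le' hq
    interval_cases k
    · rw [dCoeff_succ_zero, dCoeff_succ_zero, dCoeff_succ_zero]
      simp only [show 2 * (n + 1 + 1 + 1) = 2 * n + 1 + 1 + 1 + 1 + 1 + 1 by ring,
        show 2 * (n + 1 + 1) = 2 * n + 1 + 1 + 1 + 1 by ring,
        show 2 * (n + 1) = 2 * n + 1 + 1 by ring, Nat.factorial_succ]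
      push_cast
      field_simp
      ring
    · rw [dCoeff_succ_one, dCoeff_succ_one, dCoeff_succ_one]
      simp only [show 2 * (n + 1 + 1) = 2 * n + 1 + 1 + 1 + 1 by ring,
        show 2 * (n + 1) = 2 * n + 1 + 1 by ring, Nat.factorial_succ]
      push_cast
      field_simp
      ring
  · simp [dCoeff_eq_zero_of_two_le _ k h]
end
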